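/- Let ε > 0, t ∈ ℝ, let (a,b) ∈ ℂ² \ {(0,0)}, let k ≥ 0 be an integer and 0 ≤ p ≤ k. Then for every z ∈ ℂ², −ε⁻²·(Y₂²φ_p)(z) − (Y₃²φ_p)(z) − (Y₄²φ_p)(z) − 2it·(Y₂φ_p)(z) + ε²t²·φ_p(z) = [k(k+2) + (ε⁻² − 1)(2p−k)² + 2(2p−k)t + ε²t²]·φ_p(z). In particular, the restriction of φ_p to S³ is an eigenfunction of the magnetic Laplacian Δ_ε^α on the Berger sphere (S³, g_ε) with magnetic potential α = εt·Y₂^ε, with eigenvalue k(k+2) + (ε⁻² − 1)(2p−k)² + 2(2p−k)t + ε²t². -/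

import Mathlib

open Complex

noncomputable section

/-- The vector field `Y₂(z₁,z₂) = (i z₁, i z₂)` on `ℂ²`. -/
def Y2 (z : ℂ × ℂ) : ℂ × ℂ := (I * z.1, I * z.2)

/-- The vector field `Y₃(z₁,z₂) = (-i conj z₂, i conj z₁)` on `ℂ²`. -/
def Y3 (z : ℂ × ℂ) : ℂ × ℂ := (-I * (starRingEnd ℂ) z.2, I * (starRingEnd ℂ) z.1)

/-- The vector field `Y₄(z₁,z₂) = (conj z₂, -conj z₁)` on `ℂ²`. -/
def Y4 (z : ℂ × ℂ) : ℂ × ℂ := ((starRingEnd ℂ) z.2, -(starRingEnd ℂ) z.1)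

/-- Real Fréchet directional derivative of `f` along the vector field `X`. -/
def YD (X : ℂ × ℂ → ℂ × ℂ) (f : ℂ × ℂ → ℂ) : ℂ × ℂ → ℂ :=
  fun z => fderiv ℝ f z (X z)

/-- `u(z₁,z₂) = a z₁ + b z₂`. -/
def uF (a b : ℂ) (z : ℂ × ℂ) : ℂ := a * z.1 + b * z.2

/-- `v(z₁,z₂) = b conj z₁ - a conj z₂`. -/
def vF (a b : ℂ) (z : ℂ × ℂ) : ℂ :=
  b * (starRingEnd ℂ) z.1 - a * (starRingEnd ℂ) z.2

/-- `φ_p = uᵖ v^(k-p)` for `0 ≤ p ≤ k`, and `0` otherwise. -/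
def phi (a b : ℂ) (k p : ℤ) : ℂ × ℂ → ℂ :=
  fun z => if 0 ≤ p ∧ p ≤ k then uF a b z ^ p.toNat * vF a b z ^ (k - p).toNat else 0

/-- Product rule for a monomial in `u`, `v` with constant coefficient, along `X`. -/
lemma YD_mono (X : ℂ × ℂ → ℂ × ℂ) (a b c : ℂ) (m n : ℕ) (z : ℂ × ℂ) :
    DifferentiableAt ℝ (fun z => c * (uF a b z ^ m * vF a b z ^ n)) z ∧
    YD X (fun z => c * (uF a b z ^ m * vF a b z ^ n)) z =
      c * (m * uF a b z ^ (m - 1) * uF a b (X z) * vF a b z ^ n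
        + n * uF a b z ^ m * vF a b z ^ (n - 1) * vF a b (X z)) := by
  have h1 : HasFDerivAt (𝕜 := ℝ) (fun z : ℂ × ℂ => z.1) (ContinuousLinearMap.fst ℝ ℂ ℂ) z :=
    hasFDerivAt_fst
  have h2 : HasFDerivAt (𝕜 := ℝ) (fun z : ℂ × ℂ => z.2) (ContinuousLinearMap.snd ℝ ℂ ℂ) z :=
    hasFDerivAt_snd
  have c1 : HasFDerivAt (𝕜 := ℝ) (fun z : ℂ × ℂ => (starRingEnd ℂ) z.1) _ z :=
    (Complex.conjCLE.toContinuousLinearMap.hasFDerivAt).comp z h1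
  have c2 : HasFDerivAt (𝕜 := ℝ) (fun z : ℂ × ℂ => (starRingEnd ℂ) z.2) _ z :=
    (Complex.conjCLE.toContinuousLinearMap.hasFDerivAt).comp z h2
  have hu : HasFDerivAt (𝕜 := ℝ) (uF a b) _ z := (h1.const_mul a).add (h2.const_mul b)
  have hv : HasFDerivAt (𝕜 := ℝ) (vF a b) _ z := (c1.const_mul b).sub (c2.const_mul a)
  have h : HasFDerivAt (𝕜 := ℝ) (fun z => c * (uF a b z ^ m * vF a b z ^ n)) _ z :=
    ((hu.pow m).mul (hv.pow n)).const_mul c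
  refine ⟨h.differentiableAt, ?_⟩
  unfold YD
  rw [h.fderiv]
  simp [uF, vF]
  ring

lemma YD_add (X : ℂ × ℂ → ℂ × ℂ) (a b c d : ℂ) (m n m₂ n₂ : ℕ) (z : ℂ × ℂ) :
    YD X (fun z => c * (uF a b z ^ m * vF a b z ^ n) + d * (uF a b z ^ m₂ * vF a b z ^ n₂)) z =
      YD X (fun z => c * (uF a b z ^ m * vF a b z ^ n)) z
      + YD X (fun z => d * (uF a b z ^ m₂ * vF a b z ^ n₂)) z := by
  have h1 := (YD_mono X a b c m n z).1
  have h2 := (YD_mono X a b d m₂ n₂ z).1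
  have := fderiv_add h1 h2
  unfold YD
  exact congrArg (fun L => L (X z)) this

lemma u_Y2 (a b : ℂ) (z : ℂ × ℂ) : uF a b (Y2 z) = I * uF a b z := by
  simp [uF, Y2]; ring
lemma v_Y2 (a b : ℂ) (z : ℂ × ℂ) : vF a b (Y2 z) = -I * vF a b z := by
  simp [vF, Y2]; ring
lemma u_Y3 (a b : ℂ) (z : ℂ × ℂ) : uF a b (Y3 z) = I * vF a b z := by
  simp [uF, vF, Y3]; ring
lemma v_Y3 (a b : ℂ) (z : ℂ × ℂ) : vF a b (Y3 z) = I * uF a b z := by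
  simp [uF, vF, Y3]; ring
lemma u_Y4 (a b : ℂ) (z : ℂ × ℂ) : uF a b (Y4 z) = -vF a b z := by
  simp [uF, vF, Y4]; ring
lemma v_Y4 (a b : ℂ) (z : ℂ × ℂ) : vF a b (Y4 z) = uF a b z := by
  simp [uF, vF, Y4]; ring

lemma natCast_mul_pow (m : ℕ) (x : ℂ) : (m : ℂ) * x ^ (m - 1) * x = m * x ^ m := by
  cases m with
  | zero => simp
  | succ m => simp; ring

lemma YD_Y2_mono (a b c : ℂ) (m n : ℕ) :
    YD Y2 (fun z => c * (uF a b z ^ m * vF a b z ^ n)) =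
      fun z => (c * I * (m - n)) * (uF a b z ^ m * vF a b z ^ n) := by
  funext z
  rw [(YD_mono _ _ _ _ _ _ _).2, u_Y2, v_Y2]
  linear_combination c * I * vF a b z ^ n * natCast_mul_pow m (uF a b z)
    - c * I * uF a b z ^ m * natCast_mul_pow n (vF a b z)

/-- `X` swapping `u` and `v` up to constants: `X u = r v`, `X v = s u`. -/
lemma YD_swap (X : ℂ × ℂ → ℂ × ℂ) (a b c r s : ℂ) (hu : ∀ z, uF a b (X z) = r * vF a b z)
    (hv : ∀ z, vF a b (X z) = s * uF a b z) (m n : ℕ) :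
    YD X (fun z => c * (uF a b z ^ m * vF a b z ^ n)) =
      fun z => (c * m * r) * (uF a b z ^ (m - 1) * vF a b z ^ (n + 1))
        + (c * n * s) * (uF a b z ^ (m + 1) * vF a b z ^ (n - 1)) := by
  funext z
  rw [(YD_mono _ _ _ _ _ _ _).2, hu, hv]
  ring

lemma YD_swap_sq (X : ℂ × ℂ → ℂ × ℂ) (a b c r s : ℂ) (hu : ∀ z, uF a b (X z) = r * vF a b z)
    (hv : ∀ z, vF a b (X z) = s * uF a b z) (m n : ℕ) (z : ℂ × ℂ) :
    YD X (YD X (fun z => c * (uF a b z ^ m * vF a b z ^ n))) z =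
      c * (r ^ 2 * (m * (m - 1) * uF a b z ^ (m - 2) * vF a b z ^ (n + 2))
        + s ^ 2 * (n * (n - 1) * uF a b z ^ (m + 2) * vF a b z ^ (n - 2))
        + r * s * ((m * (n + 1) + n * (m + 1)) * (uF a b z ^ m * vF a b z ^ n))) := by
  rw [YD_swap X a b c r s hu hv, YD_add, YD_swap X a b _ r s hu hv, YD_swap X a b _ r s hu hv]
  rcases m with _ | _ | m <;> rcases n with _ | _ | n <;> simp <;> ring

/-- `φ_p` is an eigenfunction of the magnetic Laplacian
`Δ_ε^α = -(ε⁻² Y₂² + Y₃² + Y₄²) - 2it Y₂ + ε²t²` on the Berger sphere `(S³, g_ε)` with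
magnetic potential `α = εt Y₂^ε`, with eigenvalue
`k(k+2) + (ε⁻² - 1)(2p - k)² + 2(2p - k)t + ε²t²`. -/
theorem berger_magnetic_laplacian_phi (ε t : ℝ) (hε : 0 < ε) (a b : ℂ)
    (hab : (a, b) ≠ (0, 0)) (k p : ℤ) (hk : 0 ≤ k) (hp0 : 0 ≤ p) (hpk : p ≤ k) (z : ℂ × ℂ) :
    -(((ε ^ 2)⁻¹ : ℝ) : ℂ) * YD Y2 (YD Y2 (phi a b k p)) z
      - YD Y3 (YD Y3 (phi a b k p)) z - YD Y4 (YD Y4 (phi a b k p)) z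
      - 2 * I * (t : ℂ) * YD Y2 (phi a b k p) z
      + ((ε ^ 2 * t ^ 2 : ℝ) : ℂ) * phi a b k p z =
      (((k * (k + 2) : ℤ) : ℂ) + (((ε ^ 2)⁻¹ - 1 : ℝ) : ℂ) * ((2 * p - k : ℤ) : ℂ) ^ 2
        + 2 * ((2 * p - k : ℤ) : ℂ) * (t : ℂ) + ((ε ^ 2 * t ^ 2 : ℝ) : ℂ))
        * phi a b k p z := by
  obtain ⟨m, rfl⟩ := Int.eq_ofNat_of_zero_le hp0
  obtain ⟨n, hn⟩ := Int.eq_ofNat_of_zero_le (sub_nonneg.mpr hpk)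
  obtain rfl : k = m + n := by omega
  have hphi : phi a b (m + n) m = fun z => 1 * (uF a b z ^ m * vF a b z ^ n) := by
    funext z
    simp [phi]
  rw [hphi, YD_swap_sq Y3 a b 1 I I (u_Y3 a b) (v_Y3 a b),
    YD_swap_sq Y4 a b 1 (-1) 1 (fun z => by rw [u_Y4]; ring) (fun z => by rw [v_Y4]; ring),
    YD_Y2_mono, YD_Y2_mono]
  push_cast
  ring_nf
  simp only [I_sq]
  ring
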